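/- (Path-partitioning, sufficiency.) Let P' be an ancestor-to-descendant path in T with top vertex t, and let P_H be an ancestor-to-descendant path that is either completely orthogonal to P' or lies completely above P'. Let P_H be partitioned into consecutive subpaths P₁, …, P_k, ordered from farthest from the root to closest. For each i, let e_{i,1}, e_{i,2} denote the lowest and highest edges of P_i, and for b ∈ {1, 2} let e'_{i,b} be the edge of P' closest to t among those minimizing Cut(·, e_{i,b}) over the edges of P'; let E'_i be the set of edges of P' lying (inclusively) between e'_{i,1} and e'_{i,2} on P'. Then min_{1 ≤ i ≤ k} min_{e' ∈ E'_i, e ∈ P_i} Cut(e', e) = min_{e' ∈ P', e ∈ P_H} Cut(e', e); that is, to find the minimum of Cut(e', e) over all e' ∈ P' and e ∈ P_H it suffices to consider, for each i, only the pairs with e' ∈ E'_i and e ∈ P_i. -/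

import Mathlib

open SimpleGraph

variable {V : Type}

/-- `a` is a (weak) ancestor of `v` in the tree `T` rooted at `r`:
`a` lies on every `T`-path from `v` to `r`. -/
def IsAnc (T : SimpleGraph V) (r a v : V) : Prop :=
  ∀ p : T.Path v r, a ∈ p.1.support

/-- The edge `x` crosses the bipartition `(S, Sᶜ)`. -/
def Crosses (S : Set V) (x : Sym2 V) : Prop :=
  ∃ a b : V, x = s(a, b) ∧ a ∈ S ∧ b ∉ S

/-- Total weight of a set of edges. -/
noncomputable def setW (w : Sym2 V → ℕ) (S : Set (Sym2 V)) : ℕ :=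
  ∑ᶠ x ∈ S, w x

/-- Two tree edges are orthogonal: they do not lie on a common descending path
from the root (equivalently, on a common root-to-leaf path). -/
def OrthE (T : SimpleGraph V) (r : V) (f g : Sym2 V) : Prop :=
  ¬ ∃ (u : V) (q : T.Path r u), f ∈ q.1.edges ∧ g ∈ q.1.edges

/-- The edge `f'` lies (strictly) on the tree path between the edge `f` and the
vertex `t`, i.e. `f'` is closer to `t` than `f`. -/
def EdgeCloser (T : SimpleGraph V) (t : V) (f' f : Sym2 V) : Prop :=
  ∀ x y : V, f = s(x, y) →
    (∀ p : T.Path x t, f' ∈ p.1.edges) ∧ (∀ p : T.Path y t, f' ∈ p.1.edges)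

/-- `f` lies (inclusively) between the edges `g` and `h` with respect to
closeness to `t`. -/
def EdgeBetween (T : SimpleGraph V) (t : V) (g h f : Sym2 V) : Prop :=
  f = g ∨ f = h ∨ (EdgeCloser T t f g ∧ EdgeCloser T t h f) ∨
    (EdgeCloser T t f h ∧ EdgeCloser T t g f)

/-- The vertices whose tree path from the root `r` uses the edge `e`, i.e. the vertices
below `e`. -/
def below (T : SimpleGraph V) (r : V) (e : Sym2 V) : Set V :=
  {v | ∃ q : T.Path r v, e ∈ q.1.edges}

section Tree

variable {T : SimpleGraph V} {r : V}

lemma path_unique (hT : T.IsTree) {u v : V} (p q : T.Path u v) : p = q :=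
  (hT.isAcyclic.subsingleton_path u v).elim p q

lemma mem_below_iff (hT : T.IsTree) {v : V} (q : T.Path r v) (e : Sym2 V) :
    v ∈ below T r e ↔ e ∈ q.1.edges := by
  refine ⟨fun ⟨q', h⟩ => ?_, fun h => ⟨q, h⟩⟩
  rwa [path_unique hT q q']

lemma exists_path (hT : T.IsTree) (u v : V) : Nonempty (T.Path u v) := by
  classical
  exact ⟨(hT.connected.preconnected u v).some.toPath⟩

/-- A tree edge separates the vertices below `e` from the others iff it is `e`. -/
lemma mem_below_iff_of_adj (hT : T.IsTree) {x y : V} (h : T.Adj x y) (e : Sym2 V) :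
    (x ∈ below T r e ↔ y ∈ below T r e) ↔ e ≠ s(x, y) := by
  classical
  have key : ∀ {x y : V} (h : T.Adj x y) (q : T.Path r x), y ∉ q.1.support →
      ((x ∈ below T r e ↔ y ∈ below T r e) ↔ e ≠ s(x, y)) := by
    intro x y h q hy
    have hq' : (q.1.concat h).IsPath := q.2.concat hy h
    have hn : s(x, y) ∉ q.1.edges := fun hm => hy (q.1.snd_mem_support_of_mem_edges hm)
    rw [mem_below_iff hT q, mem_below_iff hT ⟨_, hq'⟩]
    simp only [Walk.edges_concat, List.concat_eq_append, List.mem_append, List.mem_singleton]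
    by_cases he : e = s(x, y)
    · subst he; simp [hn]
    · simp [he]
  obtain ⟨q⟩ := exists_path hT r x
  by_cases hy : y ∈ q.1.support
  · have hx : x ∉ (q.1.takeUntil y hy).support :=
      Walk.endpoint_notMem_support_takeUntil q.2 hy h.ne
    have := key h.symm ⟨_, q.2.takeUntil hy⟩ hx
    rw [Sym2.eq_swap, ← this]
    exact Iff.comm
  · exact key h q hy

lemma below_of_mem_support (hT : T.IsTree) {y u : V} {e : Sym2 V} (q : T.Path r u)
    (hy : y ∈ q.1.support) (h : y ∈ below T r e) : u ∈ below T r e := by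
  classical
  rw [mem_below_iff hT ⟨_, q.2.takeUntil hy⟩] at h
  exact ⟨q, Walk.edges_takeUntil_subset_edges _ hy h⟩

lemma below_subset_of_endpoint_mem (hT : T.IsTree) {y : V} {e f : Sym2 V} (hy : y ∈ f)
    (h : y ∈ below T r e) : below T r f ⊆ below T r e := by
  rintro u ⟨q, hq⟩
  exact below_of_mem_support hT q (Walk.mem_support_of_mem_edges hq hy) h

lemma exists_path_mem_support_or {u x y : V} (q : T.Path r u)
    (hx : x ∈ q.1.support) (hy : y ∈ q.1.support) :
    (∃ p : T.Path r x, y ∈ p.1.support) ∨ ∃ p : T.Path r y, x ∈ p.1.support := by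
  classical
  have hx' := hx
  rw [← q.1.take_spec hy, Walk.mem_support_append_iff] at hx'
  rcases hx' with h | h
  · exact .inr ⟨⟨_, q.2.takeUntil hy⟩, h⟩
  · left
    have hp := q.2
    rw [← q.1.take_spec hy, ← (q.1.dropUntil y hy).take_spec h, Walk.append_assoc] at hp
    exact ⟨⟨_, hp.of_append_left⟩, by simp⟩

/-- A tree edge has an endpoint below it. -/
lemma exists_endpoint_mem_below (hT : T.IsTree) {e : Sym2 V} (he : e ∈ T.edgeSet) :
    ∃ y ∈ e, y ∈ below T r e := by
  induction e using Sym2.ind with | _ x y =>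
  have h := mem_below_iff_of_adj (r := r) hT he s(x, y)
  by_cases hx : x ∈ below T r s(x, y)
  · exact ⟨x, by simp, hx⟩
  · refine ⟨y, by simp, ?_⟩
    by_contra hy
    simp [hx, hy] at h

/-- Two distinct tree edges above a common vertex are comparable. -/
lemma endpoints_mem_below_or (hT : T.IsTree) {b : V} {e f : Sym2 V} (hef : e ≠ f)
    (he : b ∈ below T r e) (hf : b ∈ below T r f) :
    (∀ z ∈ f, z ∈ below T r e) ∨ ∀ z ∈ e, z ∈ below T r f := by
  classical
  obtain ⟨q⟩ := exists_path hT r b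
  rw [mem_below_iff hT q] at he hf
  have heT := q.1.edges_subset_edgeSet he
  have hfT := q.1.edges_subset_edgeSet hf
  have all : ∀ {e f : Sym2 V}, e ≠ f → f ∈ T.edgeSet → (∃ y ∈ f, y ∈ below T r e) →
      ∀ z ∈ f, z ∈ below T r e := by
    intro e f hef hfT ⟨y, hy, hye⟩ z hz
    induction f using Sym2.ind with | _ a c =>
    have h := (mem_below_iff_of_adj (r := r) hT hfT e).2 hef
    simp only [Sym2.mem_iff] at hy hz
    rcases hy with rfl | rfl <;> rcases hz with rfl | rfl <;> tauto
  obtain ⟨y, hy, hye⟩ := exists_endpoint_mem_below (r := r) hT heT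
  obtain ⟨z, hz, hzf⟩ := exists_endpoint_mem_below (r := r) hT hfT
  rcases exists_path_mem_support_or q (Walk.mem_support_of_mem_edges he hy)
    (Walk.mem_support_of_mem_edges hf hz) with ⟨p, hp⟩ | ⟨p, hp⟩
  · exact .inr (all hef.symm heT ⟨y, hy, below_of_mem_support hT p hp hzf⟩)
  · exact .inl (all hef hfT ⟨z, hz, below_of_mem_support hT p hp hye⟩)

/-- The root path of a descendant passes through the ancestor. -/
lemma isAnc_append (hT : T.IsTree) {a v : V} (h : IsAnc T r a v) (p : T.Path r a)
    (q : T.Path a v) : (p.1.append q.1).IsPath := by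
  classical
  obtain ⟨s⟩ := exists_path hT r v
  have ha : a ∈ s.1.support := by simpa using h ⟨_, s.2.reverse⟩
  have h1 := path_unique hT p ⟨_, s.2.takeUntil ha⟩
  have h2 := path_unique hT q ⟨_, s.2.dropUntil ha⟩
  rw [h1, h2]
  simp

lemma IsAnc.of_mem_support (hT : T.IsTree) {a b x : V} (h : IsAnc T r a b) (p : T.Path a b)
    (hx : x ∈ p.1.support) : IsAnc T r a x := by
  classical
  obtain ⟨s⟩ := exists_path hT r a
  have hp := isAnc_append hT h s p
  rw [← p.1.take_spec hx, Walk.append_assoc] at hp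
  intro q
  rw [path_unique hT q ⟨_, hp.of_append_left.reverse⟩]
  simp

lemma mem_below_of_mem_edges (hT : T.IsTree) {a b : V} (h : IsAnc T r a b) (p : T.Path a b)
    {e : Sym2 V} (he : e ∈ p.1.edges) : b ∈ below T r e ∧ a ∉ below T r e := by
  obtain ⟨s⟩ := exists_path hT r a
  have hp := isAnc_append hT h s p
  refine ⟨⟨⟨_, hp⟩, by simp [he]⟩, fun ha => ?_⟩
  rw [mem_below_iff hT s] at ha
  have hnd := hp.isTrail.edges_nodup
  rw [Walk.edges_append] at hnd
  exact (List.nodup_append.1 hnd).2.2 e ha e he rfl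

/-- For a vertex below `a`, being below an edge that is not above `a` is the same as having
that edge on the path to `a`. -/
lemma mem_below_iff_mem_edges (hT : T.IsTree) {a x : V} (h : IsAnc T r a x) {e : Sym2 V}
    (ha : a ∉ below T r e) (p : T.Path x a) : x ∈ below T r e ↔ e ∈ p.1.edges := by
  obtain ⟨s⟩ := exists_path hT r a
  have hp := isAnc_append hT h s ⟨_, p.2.reverse⟩
  rw [mem_below_iff hT s] at ha
  rw [mem_below_iff hT ⟨_, hp⟩]
  simp [ha]

lemma edgeCloser_iff (hT : T.IsTree) {a b : V} (h : IsAnc T r a b) (p : T.Path a b)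
    {e f : Sym2 V} (he : e ∈ p.1.edges) (hf : f ∈ p.1.edges) :
    EdgeCloser T a e f ↔ ∀ z ∈ f, z ∈ below T r e := by
  have key : ∀ z ∈ f, ((∀ q : T.Path z a, e ∈ q.1.edges) ↔ z ∈ below T r e) := by
    intro z hz
    have hz' := h.of_mem_support hT p (Walk.mem_support_of_mem_edges hf hz)
    obtain ⟨s⟩ := exists_path hT z a
    have hi := mem_below_iff_mem_edges hT hz' (mem_below_of_mem_edges hT h p he).2
    exact ⟨fun H => (hi s).2 (H s), fun H q => (hi q).1 H⟩
  constructor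
  · intro H z hz
    exact (key z hz).1 (H z _ (Sym2.other_spec hz).symm).1
  · rintro H x y rfl
    exact ⟨(key x (by simp)).2 (H x (by simp)), (key y (by simp)).2 (H y (by simp))⟩

lemma EdgeCloser.below_subset (hT : T.IsTree) {a b : V} (h : IsAnc T r a b) (p : T.Path a b)
    {e f : Sym2 V} (he : e ∈ p.1.edges) (hf : f ∈ p.1.edges) (hc : EdgeCloser T a e f) :
    below T r f ⊆ below T r e := by
  induction f using Sym2.ind with | _ x y =>
  exact below_subset_of_endpoint_mem hT (y := x) (by simp)
    ((edgeCloser_iff hT h p he hf).1 hc x (by simp))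

lemma edgeCloser_trichotomy (hT : T.IsTree) {a b : V} (h : IsAnc T r a b) (p : T.Path a b)
    {e f : Sym2 V} (he : e ∈ p.1.edges) (hf : f ∈ p.1.edges) :
    e = f ∨ EdgeCloser T a e f ∨ EdgeCloser T a f e := by
  by_cases hef : e = f
  · exact .inl hef
  · rw [edgeCloser_iff hT h p he hf, edgeCloser_iff hT h p hf he]
    exact .inr (endpoints_mem_below_or hT hef (mem_below_of_mem_edges hT h p he).1
      (mem_below_of_mem_edges hT h p hf).1)

lemma below_subset_of_head? (hT : T.IsTree) {a b : V} (h : IsAnc T r a b) (p : T.Path a b)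
    {e g : Sym2 V} (he : p.1.edges.head? = some e) (hg : g ∈ p.1.edges) :
    below T r g ⊆ below T r e := by
  have hep : e ∈ p.1.edges := List.mem_of_head? he
  have hae : a ∈ e := by
    obtain ⟨p, hp⟩ := p
    cases p with
    | nil => simp at he
    | cons hadj p =>
      simp only [Walk.edges_cons, List.head?_cons, Option.some.injEq] at he
      simp [← he]
  by_cases hge : g = e
  · rw [hge]
  rcases endpoints_mem_below_or hT hge (mem_below_of_mem_edges hT h p hg).1
    (mem_below_of_mem_edges hT h p hep).1 with H | H
  · exact absurd (H a hae) (mem_below_of_mem_edges hT h p hg).2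
  · induction g using Sym2.ind with | _ x y =>
    exact below_subset_of_endpoint_mem hT (y := x) (by simp) (H x (by simp))

lemma below_subset_of_getLast? (hT : T.IsTree) {a b : V} (h : IsAnc T r a b) (p : T.Path a b)
    {e g : Sym2 V} (he : p.1.edges.getLast? = some e) (hg : g ∈ p.1.edges) :
    below T r e ⊆ below T r g := by
  have hbe : b ∈ e := by
    have hr : p.1.reverse.edges.head? = some e := by simpa using he
    generalize p.1.reverse = q at hr
    cases q with
    | nil => simp at hr
    | cons hadj q =>
      simp only [Walk.edges_cons, List.head?_cons, Option.some.injEq] at hr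
      simp [← hr]
  exact below_subset_of_endpoint_mem hT hbe (mem_below_of_mem_edges hT h p hg).1

end Tree

section Cut

lemma crosses_mk_iff (S : Set V) (a b : V) :
    Crosses S s(a, b) ↔ ¬ (a ∈ S ↔ b ∈ S) := by
  constructor
  · rintro ⟨x, y, hxy, hx, hy⟩
    rcases Sym2.eq_iff.1 hxy with ⟨rfl, rfl⟩ | ⟨rfl, rfl⟩ <;> tauto
  · intro h
    by_cases ha : a ∈ S
    · exact ⟨a, b, rfl, ha, by tauto⟩
    · exact ⟨b, a, Sym2.eq_swap, by tauto, ha⟩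

open Classical in
lemma setW_eq_sum [Fintype V] (w : Sym2 V → ℕ) (S : Set (Sym2 V)) :
    setW w S = ∑ x, if x ∈ S then w x else 0 := by
  rw [setW, finsum_mem_def, finsum_eq_sum_of_fintype]
  rfl

/-- The Monge inequality for cuts of symmetric differences. -/
lemma setW_symmDiff_add_le [Fintype V] (w : Sym2 V → ℕ) (E : Set (Sym2 V))
    {A A' B C : Set V} (hA : A' ⊆ A) (hB : B ⊆ C) (hd : Disjoint A C) :
    setW w {x ∈ E | Crosses (symmDiff A C) x} + setW w {x ∈ E | Crosses (symmDiff A' B) x} ≤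
      setW w {x ∈ E | Crosses (symmDiff A B) x} +
        setW w {x ∈ E | Crosses (symmDiff A' C) x} := by
  classical
  simp only [setW_eq_sum, ← Finset.sum_add_distrib]
  refine Finset.sum_le_sum fun x _ => ?_
  induction x using Sym2.ind with | _ a b =>
  have hA1 := @hA a
  have hA2 := @hA b
  have hB1 := @hB a
  have hB2 := @hB b
  have hd1 := @Set.disjoint_left.1 hd a
  have hd2 := @Set.disjoint_left.1 hd b
  simp only [Set.mem_ofPred_eq, crosses_mk_iff, Set.mem_symmDiff]
  by_cases hE : s(a, b) ∈ E
  · by_cases a ∈ A' <;> by_cases b ∈ A' <;> by_cases a ∈ A <;> by_cases b ∈ A <;>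
      by_cases a ∈ B <;> by_cases b ∈ B <;> by_cases a ∈ C <;> by_cases b ∈ C <;> simp_all
  · simp [hE]

lemma crosses_symmDiff_compl (A B : Set V) (x : Sym2 V) :
    Crosses (symmDiff A Bᶜ) x ↔ Crosses (symmDiff A B) x := by
  induction x using Sym2.ind with | _ a b =>
  simp only [crosses_mk_iff, Set.mem_symmDiff, Set.mem_compl_iff]
  tauto

/-- The tree edges crossing the symmetric difference of the vertex sets below two distinct
tree edges are these two edges. -/
lemma crosses_symmDiff_below {T : SimpleGraph V} (hT : T.IsTree) (r : V) {e f : Sym2 V}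
    (he : e ∈ T.edgeSet) (hf : f ∈ T.edgeSet) (hef : e ≠ f) :
    {x | x ∈ T.edgeSet ∧ Crosses (symmDiff (below T r e) (below T r f)) x} = {e, f} := by
  have key : ∀ x ∈ T.edgeSet,
      (Crosses (symmDiff (below T r e) (below T r f)) x ↔ x = e ∨ x = f) := by
    intro x hx
    induction x using Sym2.ind with | _ a b =>
    have h1 := mem_below_iff_of_adj (r := r) hT hx e
    have h2 := mem_below_iff_of_adj (r := r) hT hx f
    have h3 : ¬ (s(a, b) = e ∧ s(a, b) = f) := fun h => hef (h.1.symm.trans h.2)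
    rw [ne_comm, ne_eq] at h1 h2
    simp only [crosses_mk_iff, Set.mem_symmDiff]
    tauto
  ext x
  simp only [Set.mem_ofPred_eq, Set.mem_insert_iff, Set.mem_singleton_iff]
  refine ⟨fun h => (key x h.1).1 h.2, fun h => ?_⟩
  have hx : x ∈ T.edgeSet := by rcases h with rfl | rfl <;> assumption
  exact ⟨hx, (key x hx).2 h⟩

end Cut

/-- Path-partitioning, sufficiency.  With `P'` an
ancestor-to-descendant path with `L` edges and top vertex `t = a'`, `P_H` (orthogonal
to or completely above `P'`) partitioned into consecutive subpaths `P₁, …, P_k`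
(ordered lowest first), `e'_{i,1}/e'_{i,2}` the closest-to-`t` minimizers of
`Cut(·, e_{i,1})`/`Cut(·, e_{i,2})` over the edges of `P'` (for the lowest/highest
edges `e_{i,1}/e_{i,2}` of `P_i`), and `E'_i` the edges of `P'` between them,
the minimum of `Cut(e', e)` over all `e' ∈ P'`, `e ∈ P_H` equals the minimum over
the restricted pairs `e' ∈ E'_i`, `e ∈ P_i`. -/
theorem path_partitioning_sufficiency [Fintype V]
    (G T : SimpleGraph V) (hG : G.Connected) (hle : T ≤ G) (hT : T.IsTree)
    (w : Sym2 V → ℕ) (hw : ∀ x ∈ G.edgeSet, 1 ≤ w x) (r : V)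
    (cut : Sym2 V → Sym2 V → ℕ)
    (hcut : ∀ (e e' : Sym2 V) (S : Set V),
      {f : Sym2 V | f ∈ T.edgeSet ∧ Crosses S f} = {e, e'} →
      cut e e' = setW w {x ∈ G.edgeSet | Crosses S x})
    {a' b' : V} (p' : T.Path a' b') (hd' : IsAnc T r a' b')
    (k : ℕ) (c d : Fin k → V) (p : ∀ i, T.Path (c i) (d i))
    (hdesc : ∀ i, IsAnc T r (c i) (d i))
    (hchain : ∀ (i : ℕ) (h : i + 1 < k),
      c ⟨i, Nat.lt_of_succ_lt h⟩ = d ⟨i + 1, h⟩)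
    (hconfig : (∀ i, ∀ f ∈ (p i).1.edges, ∀ g ∈ p'.1.edges, OrthE T r f g) ∨
               (∀ i, ∀ f ∈ (p i).1.edges, ∀ q : T.Path r a', f ∈ q.1.edges))
    (eLow eHigh : Fin k → Sym2 V)
    (hHigh : ∀ i, ((p i).1.edges).head? = some (eHigh i))
    (hLow : ∀ i, ((p i).1.edges).getLast? = some (eLow i))
    (e1 e2 : Fin k → Sym2 V)
    (h1 : ∀ i, e1 i ∈ p'.1.edges ∧
      (∀ f ∈ p'.1.edges, cut (e1 i) (eLow i) ≤ cut f (eLow i)) ∧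
      ∀ f ∈ p'.1.edges, (∀ g ∈ p'.1.edges, cut f (eLow i) ≤ cut g (eLow i)) →
        f = e1 i ∨ EdgeCloser T a' (e1 i) f)
    (h2 : ∀ i, e2 i ∈ p'.1.edges ∧
      (∀ f ∈ p'.1.edges, cut (e2 i) (eHigh i) ≤ cut f (eHigh i)) ∧
      ∀ f ∈ p'.1.edges, (∀ g ∈ p'.1.edges, cut f (eHigh i) ≤ cut g (eHigh i)) →
        f = e2 i ∨ EdgeCloser T a' (e2 i) f) :
    sInf {n : ℕ | ∃ (i : Fin k) (f g : Sym2 V),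
        f ∈ p'.1.edges ∧ EdgeBetween T a' (e1 i) (e2 i) f ∧
        g ∈ (p i).1.edges ∧ n = cut f g}
      = sInf {n : ℕ | ∃ (f g : Sym2 V) (i : Fin k),
          f ∈ p'.1.edges ∧ g ∈ (p i).1.edges ∧ n = cut f g} := by
  classical
  have hp'T : ∀ f ∈ p'.1.edges, f ∈ T.edgeSet := fun f hf => p'.1.edges_subset_edgeSet hf
  have hpT : ∀ i, ∀ g ∈ (p i).1.edges, g ∈ T.edgeSet :=
    fun i g hg => (p i).1.edges_subset_edgeSet hg
  have hLowMem : ∀ i, eLow i ∈ (p i).1.edges := fun i => List.mem_of_getLast? (hLow i)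
  have hHighMem : ∀ i, eHigh i ∈ (p i).1.edges := fun i => List.mem_of_head? (hHigh i)
  have hne : ∀ i, ∀ f ∈ p'.1.edges, ∀ g ∈ (p i).1.edges, f ≠ g := by
    rintro i f hf g hg rfl
    rcases hconfig with H | H
    · obtain ⟨q, hq⟩ := (mem_below_of_mem_edges hT hd' p' hf).1
      exact H i f hg f hf ⟨_, q, hq, hq⟩
    · obtain ⟨q⟩ := exists_path hT r a'
      exact (mem_below_of_mem_edges hT hd' p' hf).2 ⟨q, H i f hg q⟩
  have hcut' : ∀ i, ∀ f ∈ p'.1.edges, ∀ g ∈ (p i).1.edges,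
      cut f g = setW w {x ∈ G.edgeSet | Crosses (symmDiff (below T r f) (below T r g)) x} :=
    fun i f hf g hg => hcut f g _
      (crosses_symmDiff_below hT r (hp'T f hf) (hpT i g hg) (hne i f hf g hg))
  have main : ∀ i, ∀ f ∈ p'.1.edges, ∀ g ∈ (p i).1.edges, ∃ f₀ ∈ p'.1.edges,
      EdgeBetween T a' (e1 i) (e2 i) f₀ ∧ cut f₀ g ≤ cut f g := by
    intro i f hf g hg
    obtain ⟨h1m, h1min, -⟩ := h1 i
    obtain ⟨h2m, h2min, -⟩ := h2 i
    have hsL := below_subset_of_getLast? hT (hdesc i) (p i) (hLow i) hg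
    have hsH := below_subset_of_head? hT (hdesc i) (p i) (hHigh i) hg
    have reduce : EdgeBetween T a' (e1 i) (e2 i) f ∨ cut (e1 i) g ≤ cut f g ∨
        cut (e2 i) g ≤ cut f g := by
      have sub := fun {e f} he hf hc => EdgeCloser.below_subset hT hd' p' (e := e) (f := f) he hf hc
      have outside : EdgeBetween T a' (e1 i) (e2 i) f ∨
          (below T r f ⊆ below T r (e1 i) ∧ below T r f ⊆ below T r (e2 i)) ∨
          (below T r (e1 i) ⊆ below T r f ∧ below T r (e2 i) ⊆ below T r f) := by
        rcases edgeCloser_trichotomy hT hd' p' hf h1m with h | h | h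
        · exact .inl (.inl h)
        · rcases edgeCloser_trichotomy hT hd' p' hf h2m with h' | h' | h'
          · exact .inl (.inr (.inl h'))
          · exact .inr (.inr ⟨sub hf h1m h, sub hf h2m h'⟩)
          · exact .inl (.inr (.inr (.inl ⟨h, h'⟩)))
        · rcases edgeCloser_trichotomy hT hd' p' hf h2m with h' | h' | h'
          · exact .inl (.inr (.inl h'))
          · exact .inl (.inr (.inr (.inr ⟨h', h⟩)))
          · exact .inr (.inl ⟨sub h1m hf h, sub h2m hf h'⟩)
      rcases outside with h | h
      · exact .inl h
      right
      have hL1 := h1min f hf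
      have hH2 := h2min f hf
      rw [hcut' i _ h1m _ (hLowMem i), hcut' i _ hf _ (hLowMem i)] at hL1
      rw [hcut' i _ h2m _ (hHighMem i), hcut' i _ hf _ (hHighMem i)] at hH2
      rw [hcut' i _ h1m _ hg, hcut' i _ h2m _ hg, hcut' i _ hf _ hg]
      rcases hconfig with H | H
      · have disj : ∀ f ∈ p'.1.edges, ∀ g ∈ (p i).1.edges,
            Disjoint (below T r f) (below T r g) := by
          intro f hf g hg
          rw [Set.disjoint_left]
          rintro v ⟨q, hq⟩ hv
          exact H i g hg f hf ⟨v, q, (mem_below_iff hT q g).1 hv, hq⟩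
        rcases h with ⟨s1, s2⟩ | ⟨s1, s2⟩
        · have := setW_symmDiff_add_le w G.edgeSet s1 hsL (disj _ h1m _ hg)
          omega
        · have := setW_symmDiff_add_le w G.edgeSet s2 hsH (disj _ hf _ (hHighMem i))
          omega
      · have nest : ∀ f ∈ p'.1.edges, ∀ g ∈ (p i).1.edges,
            Disjoint (below T r f) (below T r g)ᶜ := by
          intro f hf g hg
          rw [Set.disjoint_compl_right_iff_subset]
          rintro v hv
          have ha : a' ∈ below T r g := by
            obtain ⟨q⟩ := exists_path hT r a'
            exact ⟨q, H i g hg q⟩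
          obtain ⟨q, hq⟩ := hv
          induction f using Sym2.ind with | _ x y =>
          have hx := hd'.of_mem_support hT p' (Walk.mem_support_of_mem_edges hf (Sym2.mem_mk_left x y))
          obtain ⟨s⟩ := exists_path hT r x
          have hax : a' ∈ s.1.support := by simpa using hx ⟨_, s.2.reverse⟩
          exact below_subset_of_endpoint_mem hT (Sym2.mem_mk_left x y)
            (below_of_mem_support hT s hax ha) ⟨q, hq⟩
        rcases h with ⟨s1, s2⟩ | ⟨s1, s2⟩
        · have := setW_symmDiff_add_le w G.edgeSet s2 (Set.compl_subset_compl.2 hsH)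
            (nest _ h2m _ hg)
          simp only [crosses_symmDiff_compl] at this
          omega
        · have := setW_symmDiff_add_le w G.edgeSet s1 (Set.compl_subset_compl.2 hsL)
            (nest _ hf _ (hLowMem i))
          simp only [crosses_symmDiff_compl] at this
          omega
    rcases reduce with h | h | h
    · exact ⟨f, hf, h, le_rfl⟩
    · exact ⟨_, h1m, .inl rfl, h⟩
    · exact ⟨_, h2m, .inr (.inl rfl), h⟩
  have hsub : {n : ℕ | ∃ (i : Fin k) (f g : Sym2 V), f ∈ p'.1.edges ∧
      EdgeBetween T a' (e1 i) (e2 i) f ∧ g ∈ (p i).1.edges ∧ n = cut f g} ⊆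
      {n : ℕ | ∃ (f g : Sym2 V) (i : Fin k),
        f ∈ p'.1.edges ∧ g ∈ (p i).1.edges ∧ n = cut f g} := by
    rintro n ⟨i, f, g, hf, -, hg, hn⟩
    exact ⟨f, g, i, hf, hg, hn⟩
  rcases Set.eq_empty_or_nonempty {n : ℕ | ∃ (f g : Sym2 V) (i : Fin k),
      f ∈ p'.1.edges ∧ g ∈ (p i).1.edges ∧ n = cut f g} with hS | hS
  · rw [Set.subset_empty_iff.1 (hsub.trans hS.subset), hS]
  · obtain ⟨f, g, i, hf, hg, hn⟩ := Nat.sInf_mem hS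
    obtain ⟨f₀, hf₀, hb, hle₀⟩ := main i f hf g hg
    have hmem : cut f₀ g ∈ {n : ℕ | ∃ (i : Fin k) (f g : Sym2 V), f ∈ p'.1.edges ∧
        EdgeBetween T a' (e1 i) (e2 i) f ∧ g ∈ (p i).1.edges ∧ n = cut f g} :=
      ⟨i, f₀, g, hf₀, hb, hg, rfl⟩
    apply le_antisymm
    · rw [hn]
      exact (Nat.sInf_le hmem).trans hle₀
    · exact Nat.sInf_le (hsub (Nat.sInf_mem ⟨_, hmem⟩))
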